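/- For every ε > 0 there exists a constant M > 0 (depending only on ε) such that for every continuously differentiable, compactly supported u : ℝ² → ℝ² and all twice continuously differentiable, compactly supported C, C₁ : ℝ² → ℝ, |∫_{ℝ²} ΔC₁(x) (∇C(x) · u(x)) dx| ≤ ε (‖∇u‖_{L²}² + ‖ΔC‖_{L²}²) + M ‖ΔC₁‖_{L²}² (‖∇C‖_{L²}² + ‖u‖_{L²}²). -/

import Mathlib

open MeasureTheory

/-- The `i`-th partial derivative of a scalar function on `ℝ²`. -/
noncomputable def pderiv2 (f : (Fin 2 → ℝ) → ℝ) (i : Fin 2) (x : Fin 2 → ℝ) : ℝ :=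
  fderiv ℝ f x (Pi.single i 1)

/-- The Laplacian of a scalar function on `ℝ²`. -/
noncomputable def lap2 (f : (Fin 2 → ℝ) → ℝ) (x : Fin 2 → ℝ) : ℝ :=
  ∑ j, pderiv2 (pderiv2 f j) j x

lemma aux_int {f : (Fin 2 → ℝ) → ℝ} (hf : Continuous f) (hc : HasCompactSupport f) :
    Integrable f := hf.integrable_of_hasCompactSupport hc

lemma aux_int_sq {f : (Fin 2 → ℝ) → ℝ} (hf : Continuous f) (hc : HasCompactSupport f) :
    Integrable (fun x => f x ^ 2) :=
  aux_int (hf.pow 2) (hc.comp_left (g := fun y : ℝ => y ^ 2) (by simp))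

lemma aux_int_add {f g : (Fin 2 → ℝ) → ℝ} (hf : Integrable f) (hg : Integrable g) :
    Integrable (fun x => f x + g x) := hf.add hg

lemma aux_pd_cont {f : (Fin 2 → ℝ) → ℝ} (hf : ContDiff ℝ 1 f) (i : Fin 2) :
    Continuous (pderiv2 f i) :=
  (hf.continuous_fderiv (by norm_num)).clm_apply continuous_const

lemma aux_pd_contDiff {f : (Fin 2 → ℝ) → ℝ} (hf : ContDiff ℝ 2 f) (i : Fin 2) :
    ContDiff ℝ 1 (pderiv2 f i) :=
  (hf.fderiv_right (m := 1) (by norm_num)).clm_apply contDiff_const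

lemma aux_pd_supp {f : (Fin 2 → ℝ) → ℝ} (hf : HasCompactSupport f) (i : Fin 2) :
    HasCompactSupport (pderiv2 f i) :=
  hf.fderiv_apply (𝕜 := ℝ) (Pi.single i 1)

/-- Cauchy-Schwarz. -/
lemma aux_cs {f g : (Fin 2 → ℝ) → ℝ} (hf : Continuous f) (hfc : HasCompactSupport f)
    (hg : Continuous g) (hgc : HasCompactSupport g) :
    (∫ x, f x * g x) ^ 2 ≤ (∫ x, f x ^ 2) * (∫ x, g x ^ 2) := by
  have i1 : Integrable (fun x => f x ^ 2) := aux_int_sq hf hfc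
  have i2 : Integrable (fun x => g x ^ 2) := aux_int_sq hg hgc
  have i3 : Integrable (fun x => f x * g x) := aux_int (hf.mul hg) (hgc.mul_left (f := f))
  have key : ∀ t : ℝ, 0 ≤ (∫ x, f x ^ 2) * (t * t) + (2 * ∫ x, f x * g x) * t
      + ∫ x, g x ^ 2 := by
    intro t
    have h : ∫ x, (t * f x + g x) ^ 2 = (∫ x, f x ^ 2) * (t * t) + (2 * ∫ x, f x * g x) * t
      + ∫ x, g x ^ 2 := by
      have e : (fun x => (t * f x + g x) ^ 2) =
          fun x => (t * t) * f x ^ 2 + (2 * t) * (f x * g x) + g x ^ 2 := by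
        funext x; ring
      rw [e, integral_add (aux_int_add (i1.const_mul _) (i3.const_mul _)) i2,
        integral_add (i1.const_mul _) (i3.const_mul _), integral_const_mul, integral_const_mul]
      ring
    rw [← h]
    exact integral_nonneg fun x => sq_nonneg _
  have := discrim_le_zero key
  unfold discrim at this
  nlinarith

lemma aux_clm_norm (L : (Fin 2 → ℝ) →L[ℝ] ℝ) :
    ‖L‖ ≤ |L (Pi.single 0 1)| + |L (Pi.single 1 1)| := by
  refine L.opNorm_le_bound (by positivity) fun x => ?_
  have hx : x = x 0 • (Pi.single 0 1 : Fin 2 → ℝ) + x 1 • (Pi.single 1 1 : Fin 2 → ℝ) := by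
    ext i; fin_cases i <;> simp
  have e : L x = x 0 * L (Pi.single 0 1) + x 1 * L (Pi.single 1 1) := by
    conv_lhs => rw [hx]
    simp
  rw [e]
  have h0 := norm_le_pi_norm x 0
  have h1 := norm_le_pi_norm x 1
  simp only [Real.norm_eq_abs] at h0 h1 ⊢
  refine (abs_add_le _ _).trans ?_
  rw [abs_mul, abs_mul, add_mul, mul_comm |L _| ‖x‖, mul_comm |L _| ‖x‖]
  gcongr

/-- Gagliardo-Nirenberg for `f ^ 2`. -/
lemma aux_gn {f : (Fin 2 → ℝ) → ℝ} (hf : ContDiff ℝ 1 f) (hfc : HasCompactSupport f) :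
    ∫ x, f x ^ 2 ≤ (∫ x, ‖fderiv ℝ f x‖) ^ 2 := by
  have hp : Real.HolderConjugate (Fintype.card (Fin 2)) 2 := by
    rw [Real.holderConjugate_iff]; norm_num
  have h := lintegral_pow_le_pow_lintegral_fderiv_aux hp hf hfc
  have hc' : Continuous (fderiv ℝ f) := hf.continuous_fderiv (by norm_num)
  have i2 : Integrable (fun x => f x ^ 2) := aux_int_sq hf.continuous hfc
  have i1 : Integrable (fderiv ℝ f) :=
    hc'.integrable_of_hasCompactSupport (hfc.fderiv ℝ)
  rw [← ofReal_integral_norm_eq_lintegral_enorm i1] at h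
  have e : ∫⁻ x, ‖f x‖ₑ ^ (2:ℝ) = ENNReal.ofReal (∫ x, f x ^ 2) := by
    rw [ofReal_integral_eq_lintegral_ofReal i2 (Filter.Eventually.of_forall fun x => sq_nonneg _)]
    refine lintegral_congr fun x => ?_
    rw [← ofReal_norm, ENNReal.ofReal_rpow_of_nonneg (norm_nonneg _) (by norm_num)]
    congr 1
    simp
  rw [e, ENNReal.ofReal_rpow_of_nonneg (integral_nonneg fun x => norm_nonneg _) (by norm_num),
    ENNReal.ofReal_le_ofReal_iff (by positivity)] at h
  simpa using h

/-- Ladyzhenskaya's inequality. -/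
lemma aux_lady {f : (Fin 2 → ℝ) → ℝ} (hf : ContDiff ℝ 1 f) (hfc : HasCompactSupport f) :
    ∫ x, f x ^ 4 ≤ 8 * ((∫ x, f x ^ 2) * (∫ x, ∑ j, pderiv2 f j x ^ 2)) := by
  have c0 := aux_pd_cont hf 0
  have c1 := aux_pd_cont hf 1
  have s0 := aux_pd_supp hfc 0
  have s1 := aux_pd_supp hfc 1
  have hff : ContDiff ℝ 1 (fun x => f x * f x) := hf.mul hf
  have hffc : HasCompactSupport (fun x => f x * f x) := hfc.mul_left (f := f)
  have h := aux_gn hff hffc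
  set S : (Fin 2 → ℝ) → ℝ := fun x => |pderiv2 f 0 x| + |pderiv2 f 1 x| with hS
  have Sc : Continuous S := c0.abs.add c1.abs
  have Ss : HasCompactSupport S := by
    have := (s0.norm).add (s1.norm)
    exact this
  have ac : Continuous (fun x => |f x|) := hf.continuous.abs
  have as : HasCompactSupport (fun x => |f x|) := hfc.norm
  have pt : ∀ x, ‖fderiv ℝ (fun x => f x * f x) x‖ ≤ 2 * (|f x| * S x) := by
    intro x
    have hd : DifferentiableAt ℝ f x := hf.differentiable (by norm_num) x
    rw [fderiv_fun_mul hd hd, ← two_smul ℝ, norm_smul, norm_smul]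
    have := aux_clm_norm (fderiv ℝ f x)
    simp only [Real.norm_eq_abs, Nat.abs_ofNat]
    gcongr
    exact this
  have iS : Integrable (fun x => 2 * (|f x| * S x)) :=
    (aux_int (ac.mul Sc) (Ss.mul_left (f := fun x => |f x|))).const_mul 2
  have h2 : ∫ x, ‖fderiv ℝ (fun x => f x * f x) x‖ ≤ 2 * ∫ x, |f x| * S x := by
    rw [← integral_const_mul]
    exact integral_mono_of_nonneg (Filter.Eventually.of_forall fun x => norm_nonneg _) iS
      (Filter.Eventually.of_forall pt)
  have h0 : 0 ≤ ∫ x, ‖fderiv ℝ (fun x => f x * f x) x‖ := integral_nonneg fun x => norm_nonneg _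
  have cs := aux_cs ac as Sc Ss
  have sqi : ∀ j, Integrable (fun x => pderiv2 f j x ^ 2) := by
    intro j
    exact aux_int_sq (aux_pd_cont hf j) (aux_pd_supp hfc j)
  have h3 : ∫ x, S x ^ 2 ≤ 2 * ∫ x, ∑ j, pderiv2 f j x ^ 2 := by
    rw [← integral_const_mul]
    refine integral_mono_of_nonneg (Filter.Eventually.of_forall fun x => sq_nonneg _)
      ((integrable_finsetSum _ fun j _ => sqi j).const_mul 2)
      (Filter.Eventually.of_forall fun x => ?_)
    simp only [Fin.sum_univ_two, hS]
    nlinarith [sq_nonneg (|pderiv2 f 0 x| - |pderiv2 f 1 x|), sq_abs (pderiv2 f 0 x),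
      sq_abs (pderiv2 f 1 x)]
  have e4 : ∫ x, f x ^ 4 = ∫ x, (f x * f x) ^ 2 := by
    congr 1; funext x; ring
  simp only [sq_abs] at cs
  have h5 : (∫ x, f x ^ 2) * ∫ x, S x ^ 2 ≤
      (∫ x, f x ^ 2) * (2 * ∫ x, ∑ j, pderiv2 f j x ^ 2) :=
    mul_le_mul_of_nonneg_left h3 (integral_nonneg fun x => sq_nonneg _)
  have h6 := pow_le_pow_left₀ h0 h2 2
  rw [e4]
  nlinarith

lemma aux_deriv {f g : (Fin 2 → ℝ) → ℝ} (hf : Continuous f) (hfc : HasCompactSupport f)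
    (hg : ContDiff ℝ 1 g) (hgc : HasCompactSupport g) (v : Fin 2 → ℝ) :
    HasDerivAt (fun s : ℝ => ∫ x, f x * g (x + s • v)) (∫ x, f x * fderiv ℝ g x v) 0 := by
  have hc' : Continuous (fun x => fderiv ℝ g x v) :=
    (hg.continuous_fderiv (by norm_num)).clm_apply continuous_const
  obtain ⟨B, hB⟩ := hc'.bounded_above_of_compact_support (hgc.fderiv_apply (𝕜 := ℝ) v)
  have := hasDerivAt_integral_of_dominated_loc_of_deriv_le (μ := (volume : Measure (Fin 2 → ℝ)))
    (F := fun (s : ℝ) x => f x * g (x + s • v))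
    (F' := fun (s : ℝ) x => f x * fderiv ℝ g (x + s • v) v) (x₀ := (0:ℝ)) (s := Set.univ)
    (bound := fun x => ‖f x‖ * B) Filter.univ_mem ?_ ?_ ?_ ?_ ?_ ?_
  · simpa using this.2
  · refine Filter.Eventually.of_forall fun s => Continuous.aestronglyMeasurable ?_
    have := hg.continuous
    fun_prop
  · simp only [zero_smul, add_zero]
    exact aux_int (hf.mul hg.continuous) (hgc.mul_left (f := f))
  · refine Continuous.aestronglyMeasurable ?_
    simp only [zero_smul, add_zero]
    exact hf.mul hc'
  · refine Filter.Eventually.of_forall fun x s _ => ?_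
    rw [norm_mul]
    gcongr
    exact hB _
  · exact (aux_int hf hfc).norm.mul_const B
  · refine Filter.Eventually.of_forall fun x s _ => HasDerivAt.const_mul _ ?_
    have h1 : HasDerivAt (fun s : ℝ => x + s • v) v s := by
      simpa using ((hasDerivAt_id s).smul_const v).const_add x
    exact ((hg.differentiable (by norm_num) _).hasFDerivAt).comp_hasDerivAt s h1

lemma aux_swap {f g : (Fin 2 → ℝ) → ℝ} (hf : ContDiff ℝ 1 f) (hfc : HasCompactSupport f)
    (hg : ContDiff ℝ 1 g) (hgc : HasCompactSupport g) (v w : Fin 2 → ℝ) :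
    ∫ x, fderiv ℝ f x w * fderiv ℝ g x v = ∫ x, fderiv ℝ g x w * fderiv ℝ f x v := by
  have cf : Continuous (fun x => fderiv ℝ f x w) :=
    (hf.continuous_fderiv (by norm_num)).clm_apply continuous_const
  have cg : Continuous (fun x => fderiv ℝ g x w) :=
    (hg.continuous_fderiv (by norm_num)).clm_apply continuous_const
  have sf := hfc.fderiv_apply (𝕜 := ℝ) w
  have sg := hgc.fderiv_apply (𝕜 := ℝ) w
  have h1 := aux_deriv cf sf hg hgc v
  have h2 := aux_deriv cg sg hf hfc (-v)
  have e : (fun s : ℝ => ∫ x, fderiv ℝ f x w * g (x + s • v)) =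
      fun s => - ∫ x, fderiv ℝ g x w * f (x + s • (-v)) := by
    funext s
    have hgs : ContDiff ℝ 1 (fun x => g (x + s • v)) := hg.comp (contDiff_id.add contDiff_const)
    have cgs : Continuous (fun x => fderiv ℝ g (x + s • v) w) :=
      cg.comp (continuous_id.add continuous_const)
    have ibp := integral_mul_fderiv_eq_neg_fderiv_mul_of_integrable
      (μ := (volume : Measure (Fin 2 → ℝ))) (f := f) (g := fun x => g (x + s • v)) (v := w)
      (aux_int (cf.mul hgs.continuous) (sf.mul_right)) 
      (by
        simp only [fderiv_comp_add_right]
        exact aux_int (hf.continuous.mul cgs) (hfc.mul_right))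
      (aux_int (hf.continuous.mul hgs.continuous) (hfc.mul_right))
      (fun x _ => hf.differentiable (by norm_num) x)
      (fun x _ => hgs.differentiable (by norm_num) x)
    simp only [fderiv_comp_add_right] at ibp
    rw [eq_comm, neg_eq_iff_eq_neg, ← ibp,
      ← integral_add_right_eq_self (fun x => fderiv ℝ g x w * f (x + s • (-v))) (s • v)]
    congr 1; funext x
    rw [smul_neg, add_neg_cancel_right, mul_comm]
  rw [e] at h1
  have := h1.unique h2.neg
  rw [this, ← integral_neg]
  congr 1; funext x
  simp

lemma aux_symm {f : (Fin 2 → ℝ) → ℝ} (hf : ContDiff ℝ 2 f) (i j : Fin 2) (x : Fin 2 → ℝ) :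
    pderiv2 (pderiv2 f i) j x = pderiv2 (pderiv2 f j) i x := by
  have hs : IsSymmSndFDerivAt ℝ f x := hf.contDiffAt.isSymmSndFDerivAt (by simp)
  have hd : DifferentiableAt ℝ (fderiv ℝ f) x :=
    (hf.fderiv_right (m := 1) (by norm_num)).differentiable (by norm_num) x
  have e : ∀ i j : Fin 2, pderiv2 (pderiv2 f i) j x =
      fderiv ℝ (fderiv ℝ f) x (Pi.single j 1) (Pi.single i 1) := by
    intro i j
    have : pderiv2 f i = fun y => fderiv ℝ f y (Pi.single i 1) := rfl
    rw [pderiv2, this, fderiv_clm_apply hd (differentiableAt_const _)]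
    simp
  rw [e, e]
  exact hs _ _

lemma aux_hess {f : (Fin 2 → ℝ) → ℝ} (hf : ContDiff ℝ 2 f) (hfc : HasCompactSupport f) :
    ∑ i, ∫ x, ∑ j, pderiv2 (pderiv2 f i) j x ^ 2 = ∫ x, lap2 f x ^ 2 := by
  have im : ∀ i j k l, Integrable
      (fun x => pderiv2 (pderiv2 f i) j x * pderiv2 (pderiv2 f k) l x) := fun i j k l =>
    aux_int ((aux_pd_cont (aux_pd_contDiff hf i) j).mul (aux_pd_cont (aux_pd_contDiff hf k) l))
      ((aux_pd_supp (aux_pd_supp hfc i) j).mul_right)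
  have sw := aux_swap (aux_pd_contDiff hf 0) (aux_pd_supp hfc 0) (aux_pd_contDiff hf 1)
    (aux_pd_supp hfc 1) (Pi.single 0 1) (Pi.single 1 1)
  change ∫ x, pderiv2 (pderiv2 f 0) 1 x * pderiv2 (pderiv2 f 1) 0 x =
    ∫ x, pderiv2 (pderiv2 f 1) 1 x * pderiv2 (pderiv2 f 0) 0 x at sw
  have e : (fun x => lap2 f x ^ 2) = fun x =>
      (pderiv2 (pderiv2 f 0) 0 x * pderiv2 (pderiv2 f 0) 0 x +
      pderiv2 (pderiv2 f 1) 1 x * pderiv2 (pderiv2 f 1) 1 x) +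
      2 * (pderiv2 (pderiv2 f 1) 1 x * pderiv2 (pderiv2 f 0) 0 x) := by
    funext x; simp only [lap2, Fin.sum_univ_two]; ring
  rw [e, integral_add (aux_int_add (im _ _ _ _) (im _ _ _ _)) ((im _ _ _ _).const_mul _),
    integral_add (im _ _ _ _) (im _ _ _ _), integral_const_mul, ← sw]
  simp only [Fin.sum_univ_two, sq]
  rw [integral_add (im _ _ _ _) (im _ _ _ _), integral_add (im _ _ _ _) (im _ _ _ _)]
  simp only [aux_symm hf 1 0]
  ring

/-- Estimate (25) of the paper:
`|∫ ΔC₁ (∇C · u)| ≤ ε (‖∇u‖² + ‖ΔC‖²) + M ‖ΔC₁‖² (‖∇C‖² + ‖u‖²)`. -/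
theorem estimate_laplacian_against_grad_dot_u :
    ∀ ε : ℝ, 0 < ε → ∃ M : ℝ, 0 < M ∧
      ∀ (u : (Fin 2 → ℝ) → (Fin 2 → ℝ)) (C C₁ : (Fin 2 → ℝ) → ℝ),
        ContDiff ℝ 1 u → HasCompactSupport u →
        ContDiff ℝ 2 C → HasCompactSupport C →
        ContDiff ℝ 2 C₁ → HasCompactSupport C₁ →
        |∫ x, lap2 C₁ x * (∑ i, pderiv2 C i x * u x i)| ≤
          ε * ((∫ x, ∑ i, ∑ j, (pderiv2 (fun y => u y i) j x) ^ 2) +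
                (∫ x, (lap2 C x) ^ 2)) +
            M * (∫ x, (lap2 C₁ x) ^ 2) *
              ((∫ x, ∑ i, (pderiv2 C i x) ^ 2) + (∫ x, ∑ i, (u x i) ^ 2)) := by
  intro ε hε
  refine ⟨2 / ε, by positivity, ?_⟩
  intro u C C₁ hu huc hC hCc hC1 hC1c
  have hui : ∀ i, ContDiff ℝ 1 (fun y => u y i) := fun i => contDiff_pi.1 hu i
  have huic : ∀ i, HasCompactSupport (fun y => u y i) := fun i =>
    huc.comp_left (g := fun v : Fin 2 → ℝ => v i) rfl
  have hp := aux_pd_contDiff hC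
  have hpc := aux_pd_supp hCc
  have lc : Continuous (lap2 C₁) := by
    unfold lap2
    exact continuous_finsetSum _ fun j _ => aux_pd_cont (aux_pd_contDiff hC1 j) j
  have ls : HasCompactSupport (lap2 C₁) := by
    have := (aux_pd_supp (aux_pd_supp hC1c 0) 0).add (aux_pd_supp (aux_pd_supp hC1c 1) 1)
    have e : lap2 C₁ = pderiv2 (pderiv2 C₁ 0) 0 + pderiv2 (pderiv2 C₁ 1) 1 := by
      funext x; simp [lap2, Fin.sum_univ_two]
    rwa [e]
  have gc : Continuous (fun x => ∑ i, pderiv2 C i x * u x i) :=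
    continuous_finsetSum _ fun i _ => (hp i).continuous.mul (hui i).continuous
  have gs : HasCompactSupport (fun x => ∑ i, pderiv2 C i x * u x i) := by
    have := ((hpc 0).mul_right (f' := fun x => u x 0)).add
      ((hpc 1).mul_right (f' := fun x => u x 1))
    have e : (fun x => ∑ i, pderiv2 C i x * u x i) =
      (pderiv2 C 0 * fun x => u x 0) + (pderiv2 C 1 * fun x => u x 1) := by
      funext x; simp [Fin.sum_univ_two]
    rw [e]; exact this
  have cs := aux_cs lc ls gc gs
  have pw : ∀ {f : (Fin 2 → ℝ) → ℝ}, Continuous f → HasCompactSupport f → ∀ n : ℕ,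
      n ≠ 0 → Integrable (fun x => f x ^ n) := fun hf hfc n hn =>
    aux_int (hf.pow n) (hfc.comp_left (g := fun y : ℝ => y ^ n) (by simp [hn]))
  have ip4 := fun i => pw (hp i).continuous (hpc i) 4 (by norm_num)
  have iu4 := fun i => pw (hui i).continuous (huic i) 4 (by norm_num)
  have ip2 := fun i => pw (hp i).continuous (hpc i) 2 (by norm_num)
  have iu2 := fun i => pw (hui i).continuous (huic i) 2 (by norm_num)
  have idu := fun i j => pw (aux_pd_cont (hui i) j) (aux_pd_supp (huic i) j) 2 (by norm_num)
  have b1 : ∫ x, (∑ i, pderiv2 C i x * u x i) ^ 2 ≤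
      ∑ i, ((∫ x, pderiv2 C i x ^ 4) + ∫ x, u x i ^ 4) := by
    have e : ∑ i, ((∫ x, pderiv2 C i x ^ 4) + ∫ x, u x i ^ 4) =
        ∫ x, ∑ i, (pderiv2 C i x ^ 4 + u x i ^ 4) := by
      rw [integral_finsetSum _ fun i _ => aux_int_add (ip4 i) (iu4 i)]
      exact Finset.sum_congr rfl fun i _ => (integral_add (ip4 i) (iu4 i)).symm
    rw [e]
    refine integral_mono_of_nonneg (Filter.Eventually.of_forall fun x => sq_nonneg _)
      (integrable_finsetSum _ fun i _ => aux_int_add (ip4 i) (iu4 i))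
      (Filter.Eventually.of_forall fun x => ?_)
    simp only [Fin.sum_univ_two]
    nlinarith [sq_nonneg (pderiv2 C 0 x * u x 0 - pderiv2 C 1 x * u x 1),
      sq_nonneg (pderiv2 C 0 x ^ 2 - u x 0 ^ 2), sq_nonneg (pderiv2 C 1 x ^ 2 - u x 1 ^ 2)]
  have L1 := fun i => aux_lady (hp i) (hpc i)
  have L2 := fun i => aux_lady (hui i) (huic i)
  rw [← aux_hess hC hCc, integral_finsetSum _ fun i _ => ip2 i,
    integral_finsetSum _ fun i _ => iu2 i,
    integral_finsetSum _ fun i _ => integrable_finsetSum _ fun j _ => idu i j]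
  simp only [Fin.sum_univ_two (f := fun i => ∫ x, pderiv2 C i x ^ 2),
    Fin.sum_univ_two (f := fun i => ∫ x, u x i ^ 2),
    Fin.sum_univ_two (f := fun i => ∫ x, ∑ j, pderiv2 (fun y => u y i) j x ^ 2),
    Fin.sum_univ_two (f := fun i => ∫ x, ∑ j, pderiv2 (pderiv2 C i) j x ^ 2),
    Fin.sum_univ_two (f := fun i => ((∫ x, pderiv2 C i x ^ 4) + ∫ x, u x i ^ 4))] at b1 ⊢
  have L10 := L1 0
  have L11 := L1 1
  have L20 := L2 0
  have L21 := L2 1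
  have n1 : ∀ i, 0 ≤ ∫ x, pderiv2 C i x ^ 2 := fun i => integral_nonneg fun x => sq_nonneg _
  have n2 : ∀ i, 0 ≤ ∫ x, u x i ^ 2 := fun i => integral_nonneg fun x => sq_nonneg _
  have n3 : ∀ i, 0 ≤ ∫ x, ∑ j, pderiv2 (fun y => u y i) j x ^ 2 := fun i =>
    integral_nonneg fun x => Finset.sum_nonneg fun j _ => sq_nonneg _
  have n4 : ∀ i, 0 ≤ ∫ x, ∑ j, pderiv2 (pderiv2 C i) j x ^ 2 := fun i =>
    integral_nonneg fun x => Finset.sum_nonneg fun j _ => sq_nonneg _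
  have na : 0 ≤ ∫ x, lap2 C₁ x ^ 2 := integral_nonneg fun x => sq_nonneg _
  have n10 := n1 0
  have n11 := n1 1
  have n20 := n2 0
  have n21 := n2 1
  have n30 := n3 0
  have n31 := n3 1
  have n40 := n4 0
  have n41 := n4 1
  clear n1 n2 n3 n4 L1 L2
  generalize (∫ x, lap2 C₁ x * (∑ i, pderiv2 C i x * u x i)) = I at *
  generalize (∫ x, (∑ i, pderiv2 C i x * u x i) ^ 2) = b at *
  generalize (∫ x, lap2 C₁ x ^ 2) = a at *
  generalize (∫ x, pderiv2 C 0 x ^ 2) = p0 at *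
  generalize (∫ x, pderiv2 C 1 x ^ 2) = p1 at *
  generalize (∫ x, u x 0 ^ 2) = q0 at *
  generalize (∫ x, u x 1 ^ 2) = q1 at *
  generalize (∫ x, ∑ j, pderiv2 (fun y => u y 0) j x ^ 2) = Q0 at *
  generalize (∫ x, ∑ j, pderiv2 (fun y => u y 1) j x ^ 2) = Q1 at *
  generalize (∫ x, ∑ j, pderiv2 (pderiv2 C 0) j x ^ 2) = P0 at *
  generalize (∫ x, ∑ j, pderiv2 (pderiv2 C 1) j x ^ 2) = P1 at *
  have hb : b ≤ 8 * ((p0 + p1 + (q0 + q1)) * (Q0 + Q1 + (P0 + P1))) := by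
    have : 0 ≤ p0 * (Q0 + Q1 + P1) + p1 * (Q0 + Q1 + P0) + q0 * (Q1 + P0 + P1)
      + q1 * (Q0 + P0 + P1) := by positivity
    nlinarith
  have hI : I ^ 2 ≤ a * (8 * ((p0 + p1 + (q0 + q1)) * (Q0 + Q1 + (P0 + P1)))) :=
    cs.trans (mul_le_mul_of_nonneg_left hb na)
  have hX : 0 ≤ Q0 + Q1 + (P0 + P1) := by positivity
  have hY : 0 ≤ p0 + p1 + (q0 + q1) := by positivity
  generalize Q0 + Q1 + (P0 + P1) = X at *
  generalize p0 + p1 + (q0 + q1) = Y at *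
  refine abs_le_of_sq_le_sq (hI.trans ?_) (by positivity)
  have key : (ε * X + 2 / ε * a * Y) ^ 2 - a * (8 * (Y * X)) = (ε * X - 2 / ε * a * Y) ^ 2 := by
    field_simp
    ring
  nlinarith [sq_nonneg (ε * X - 2 / ε * a * Y)]
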